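/- Kernel smoothing bias bound under a Hölder condition. Let (𝓕, d) be a pseudometric space, X an 𝓕-valued random element on a probability space, x ∈ 𝓕, h > 0, and K : ℝ → [0, ∞) a measurable function vanishing outside the interval (0, 1) such that 0 < E[K(d(x, X)/h)] < ∞. Let g : 𝓕 → ℝ be measurable with K(d(x, X)/h) g(X) integrable, and suppose there exist constants C > 0 and k > 0 such that |g(u) − g(x)| ≤ C d(x, u)^k for every u ∈ 𝓕 with d(x, u) ≤ h. Then | E[K(d(x, X)/h) g(X)] / E[K(d(x, X)/h)] − g(x) | ≤ C h^k. -/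

import Mathlib

open MeasureTheory

/-- Kernel smoothing bias bound under a Hölder condition:
`|E[K(d(x,X)/h) g(X)] / E[K(d(x,X)/h)] − g(x)| ≤ C h^k`. -/
theorem kernel_bias_bound {𝓕 Ω : Type*} [PseudoMetricSpace 𝓕]
    [MeasurableSpace 𝓕] [MeasurableSpace Ω]
    (μ : Measure Ω) [IsProbabilityMeasure μ] (X : Ω → 𝓕) (hX : Measurable X)
    (x : 𝓕) (h : ℝ) (hh : 0 < h) (K : ℝ → ℝ) (hKmeas : Measurable K)
    (hKnonneg : ∀ u, 0 ≤ K u) (hKsupp : ∀ u, u ∉ Set.Ioo (0 : ℝ) 1 → K u = 0)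
    (hKint : Integrable (fun ω => K (dist x (X ω) / h)) μ)
    (hEKpos : 0 < ∫ ω, K (dist x (X ω) / h) ∂μ)
    (g : 𝓕 → ℝ) (hg : Measurable g)
    (hint : Integrable (fun ω => K (dist x (X ω) / h) * g (X ω)) μ)
    (C k : ℝ) (hC : 0 < C) (hk : 0 < k)
    (hHolder : ∀ u : 𝓕, dist x u ≤ h → |g u - g x| ≤ C * dist x u ^ k) :
    |(∫ ω, K (dist x (X ω) / h) * g (X ω) ∂μ) /
        (∫ ω, K (dist x (X ω) / h) ∂μ) - g x| ≤ C * h ^ k := by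
  have hpt (ω : Ω) : |K (dist x (X ω) / h) * g (X ω) - K (dist x (X ω) / h) * g x| ≤
      K (dist x (X ω) / h) * (C * h ^ k) := by
    rw [← mul_sub, abs_mul, abs_of_nonneg (hKnonneg _)]
    by_cases hω : dist x (X ω) / h ∈ Set.Ioo (0 : ℝ) 1
    · have hdist : dist x (X ω) ≤ h := ((div_lt_one hh).mp hω.2).le
      have hpow : dist x (X ω) ^ k ≤ h ^ k := Real.rpow_le_rpow dist_nonneg hdist hk.le
      exact mul_le_mul_of_nonneg_left
        ((hHolder _ hdist).trans (mul_le_mul_of_nonneg_left hpow hC.le)) (hKnonneg _)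
    · simp [hKsupp _ hω]
  rw [div_sub' hEKpos.ne', abs_div, abs_of_pos hEKpos, div_le_iff₀ hEKpos,
    ← integral_mul_const, ← integral_sub hint (hKint.mul_const _),
    mul_comm (C * h ^ k), ← integral_mul_const]
  exact abs_integral_le_integral_abs.trans
    (integral_mono (hint.sub (hKint.mul_const _)).abs (hKint.mul_const _) hpt)
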